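/- Let ε ∈ {−1,0,1}, r > 0 with r ≤ 1 if ε ≠ 0, x ∈ ℝ² with |x| < r, and ξ ∈ ℝ². With b_{i|j}(x) = ((1+εr²)/((r²−|x|²)(1+ε|x|²)))·(δ_{ij} − 2εx^ix^j/(1+ε|x|²)), Γ^k_{ij}(x) = (x^iδ_{kj}+x^jδ_{ki})/(r²−|x|²), and the second covariant derivative b_{i|j|k}(x) = ∂b_{i|j}/∂x^k(x) − Σ_m b_{i|m}(x)Γ^m_{jk}(x) − Σ_m b_{j|m}(x)Γ^m_{ik}(x), one has Σ_{i,j,k} b_{i|j|k}(x)ξ^iξ^jξ^k = ( −2(1+εr²)⟨x,ξ⟩ / ((1+ε|x|²)³(r²−|x|²)²) ) · [ (1+ε|x|²)|ξ|²(3εr² − 2ε|x|² + 1) − 2ε⟨x,ξ⟩²(1 − ε|x|² + 2εr²) ]. -/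

import Mathlib

open RealInnerProductSpace

/-- Closed form of the covariant derivative `b_{i|j}` of the 1-form β with respect to α. -/
noncomputable def bCov (ε r : ℝ) (x : EuclideanSpace ℝ (Fin 2)) (i j : Fin 2) : ℝ :=
  ((1 + ε * r ^ 2) / ((r ^ 2 - ‖x‖ ^ 2) * (1 + ε * ‖x‖ ^ 2))) *
    ((if i = j then (1 : ℝ) else 0) - 2 * ε * x i * x j / (1 + ε * ‖x‖ ^ 2))

/-- Christoffel symbols of the Riemannian metric α. -/
noncomputable def christoffel (r : ℝ) (x : EuclideanSpace ℝ (Fin 2)) (k i j : Fin 2) : ℝ :=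
  (x i * (if k = j then (1 : ℝ) else 0) + x j * (if k = i then (1 : ℝ) else 0))
    / (r ^ 2 - ‖x‖ ^ 2)

/-- Second covariant derivative
`b_{i|j|k} = ∂b_{i|j}/∂x^k − Σ_m b_{i|m}Γ^m_{jk} − Σ_m b_{j|m}Γ^m_{ik}`. -/
noncomputable def bCov2 (ε r : ℝ) (x : EuclideanSpace ℝ (Fin 2)) (i j k : Fin 2) : ℝ :=
  fderiv ℝ (fun y => bCov ε r y i j) x (EuclideanSpace.single k 1)
    - ∑ m, bCov ε r x i m * christoffel r x m j k
    - ∑ m, bCov ε r x j m * christoffel r x m i k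

theorem fderiv_bCov_apply {ε r : ℝ} {x : EuclideanSpace ℝ (Fin 2)}
    (hA : r ^ 2 - ‖x‖ ^ 2 ≠ 0) (hB : 1 + ε * ‖x‖ ^ 2 ≠ 0) (i j : Fin 2)
    (v : EuclideanSpace ℝ (Fin 2)) :
    fderiv ℝ (fun y => bCov ε r y i j) x v
      = (1 + ε * r ^ 2) * (2 * ⟪x, v⟫ / ((r ^ 2 - ‖x‖ ^ 2) ^ 2 * (1 + ε * ‖x‖ ^ 2))
            - 2 * ε * ⟪x, v⟫ / ((r ^ 2 - ‖x‖ ^ 2) * (1 + ε * ‖x‖ ^ 2) ^ 2)) *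
          ((if i = j then (1 : ℝ) else 0) - 2 * ε * x i * x j / (1 + ε * ‖x‖ ^ 2))
        - (1 + ε * r ^ 2) / ((r ^ 2 - ‖x‖ ^ 2) * (1 + ε * ‖x‖ ^ 2)) *
          (2 * ε * (v i * x j + x i * v j) / (1 + ε * ‖x‖ ^ 2)
            - 4 * ε ^ 2 * x i * x j * ⟪x, v⟫ / (1 + ε * ‖x‖ ^ 2) ^ 2) := by
  have hs : HasFDerivAt (fun y : EuclideanSpace ℝ (Fin 2) => ‖y‖ ^ 2) _ x :=
    (hasStrictFDerivAt_norm_sq x).hasFDerivAt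
  have hc (l : Fin 2) : HasFDerivAt (fun y : EuclideanSpace ℝ (Fin 2) => y l) _ x :=
    (EuclideanSpace.proj l : EuclideanSpace ℝ (Fin 2) →L[ℝ] ℝ).hasFDerivAt
  have hdA := hs.const_sub (r ^ 2)
  have hdB := (hs.const_mul ε).const_add 1
  have hAB := (hasDerivAt_inv (mul_ne_zero hA hB)).comp_hasFDerivAt x (hdA.mul hdB)
  have hBinv := (hasDerivAt_inv hB).comp_hasFDerivAt x hdB
  have h := (hAB.const_mul (1 + ε * r ^ 2)).mul
    (((((hc i).const_mul (2 * ε)).mul (hc j)).mul hBinv).const_sub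
      (if i = j then (1 : ℝ) else 0))
  simp only [bCov, div_eq_mul_inv (1 + ε * r ^ 2), div_eq_mul_inv (2 * ε * _ * _)]
  refine (congrArg (· v) h.fderiv).trans ?_
  simp
  field_simp
  ring

/-- The contraction `ψ = Σ b_{i|j|k}ξ^iξ^jξ^k` of the second covariant derivative of β. -/
theorem funk_finsler_psi (ε r : ℝ) (hε : ε = -1 ∨ ε = 0 ∨ ε = 1) (hr : 0 < r)
    (hr1 : ε ≠ 0 → r ≤ 1) (x : EuclideanSpace ℝ (Fin 2)) (hx : ‖x‖ < r)
    (ξ : EuclideanSpace ℝ (Fin 2)) :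
    ∑ i, ∑ j, ∑ k, bCov2 ε r x i j k * ξ i * ξ j * ξ k
      = (-2 * (1 + ε * r ^ 2) * ⟪x, ξ⟫ / ((1 + ε * ‖x‖ ^ 2) ^ 3 * (r ^ 2 - ‖x‖ ^ 2) ^ 2)) *
          ((1 + ε * ‖x‖ ^ 2) * ‖ξ‖ ^ 2 * (3 * ε * r ^ 2 - 2 * ε * ‖x‖ ^ 2 + 1)
            - 2 * ε * ⟪x, ξ⟫ ^ 2 * (1 - ε * ‖x‖ ^ 2 + 2 * ε * r ^ 2)) := by
  have hx0 := norm_nonneg x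
  have hA : r ^ 2 - ‖x‖ ^ 2 ≠ 0 := by nlinarith
  have hB : 1 + ε * ‖x‖ ^ 2 ≠ 0 := by
    rcases hε with rfl | rfl | rfl
    · have := hr1 (by norm_num)
      nlinarith
    · norm_num
    · positivity
  have hp : ⟪x, ξ⟫ = x 0 * ξ 0 + x 1 * ξ 1 := by
    simp [PiLp.inner_apply, mul_comm]
  have hq : ‖ξ‖ ^ 2 = ξ 0 ^ 2 + ξ 1 ^ 2 := by
    simp [EuclideanSpace.norm_sq_eq]
  simp only [bCov2, fderiv_bCov_apply hA hB, hp, hq]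
  simp only [bCov, christoffel, Fin.sum_univ_two, EuclideanSpace.inner_single_right]
  generalize ‖x‖ ^ 2 = s at *
  simp
  field_simp
  ring
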